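/- arXiv:0706.0051 — 3 statements merged into one kernel-verified Lean document; each statement's English description precedes it below -/
import Mathlib

section
/- Let U be a deterministic utility field on [0,T]. Then there exist utility functions u̲ and ū (each strictly concave, strictly increasing, continuously differentiable on (0,∞) and satisfying the Inada conditions) such that u̲(x) ≤ U(t,x) ≤ ū(x) for all x > 0 and all t ∈ [0,T]. -/
open MeasureTheory Filter Set

noncomputable section

/-- A utility function `u` on `(0,∞)` with (continuous) derivative `u'`:
strictly concave, strictly increasing, continuously differentiable,
satisfying the Inada conditions `u'(0+) = ∞` and `u'(∞) = 0`. -/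
structure IsUtilityFun (u u' : ℝ → ℝ) : Prop where
  strictConcave : StrictConcaveOn ℝ (Set.Ioi (0:ℝ)) u
  strictMono : StrictMonoOn u (Set.Ioi (0:ℝ))
  hasDeriv : ∀ x ∈ Set.Ioi (0:ℝ), HasDerivAt u (u' x) x
  derivCont : ContinuousOn u' (Set.Ioi (0:ℝ))
  inada_zero : Filter.Tendsto u' (nhdsWithin 0 (Set.Ioi 0)) Filter.atTop
  inada_infty : Filter.Tendsto u' Filter.atTop (nhds 0)

/-- A deterministic utility field `U` on `[0,T]`, with partial derivative `U'`
in the wealth variable. -/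
structure IsUtilityField (T : ℝ) (U U' : ℝ → ℝ → ℝ) : Prop where
  jointlyMeasurable : Measurable (fun p : ℝ × ℝ => U p.1 p.2)
  utility : ∀ t ∈ Set.Icc (0:ℝ) T, IsUtilityFun (U t) (U' t)
  marginal_bounds : ∃ K₁ K₂ : ℝ → ℝ,
    ContinuousOn K₁ (Set.Ioi 0) ∧ ContinuousOn K₂ (Set.Ioi 0) ∧
    StrictAntiOn K₁ (Set.Ioi 0) ∧ StrictAntiOn K₂ (Set.Ioi 0) ∧
    (∀ x > (0:ℝ), 0 < K₁ x) ∧ (∀ x > (0:ℝ), 0 < K₂ x) ∧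
    (∀ t ∈ Set.Icc (0:ℝ) T, ∀ x > (0:ℝ), K₁ x ≤ U' t x ∧ U' t x ≤ K₂ x) ∧
    (∃ M : ℝ, ∀ᶠ x in Filter.atTop, K₂ x / K₁ x ≤ M)
  bounded_at_one : ∃ M : ℝ, ∀ t ∈ Set.Icc (0:ℝ) T, |U t 1| ≤ M
  eventually_pos : ∃ ε > (0:ℝ), ∃ x₀ : ℝ, ∀ x ≥ x₀, ∀ t ∈ Set.Icc (0:ℝ) T, ε ≤ U t x

/-- A function whose derivative is positive, continuous, strictly decreasing and satisfies the
Inada conditions is a utility function. -/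
theorem IsUtilityFun.of_deriv {u u' : ℝ → ℝ} (hd : ∀ x > (0 : ℝ), HasDerivAt u (u' x) x)
    (hpos : ∀ x > (0 : ℝ), 0 < u' x) (hanti : StrictAntiOn u' (Ioi 0))
    (hcont : ContinuousOn u' (Ioi 0)) (hzero : Tendsto u' (nhdsWithin 0 (Ioi 0)) atTop)
    (hinfty : Tendsto u' atTop (nhds 0)) : IsUtilityFun u u' := by
  have hc : ContinuousOn u (Ioi 0) := fun x hx => (hd x hx).continuousAt.continuousWithinAt
  refine ⟨?_, ?_, hd, hcont, hzero, hinfty⟩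
  · refine StrictAntiOn.strictConcaveOn_of_deriv (convex_Ioi 0) hc ?_
    rw [interior_Ioi]
    exact hanti.congr fun x hx => (hd x hx).deriv.symm
  · refine strictMonoOn_of_deriv_pos (convex_Ioi 0) hc fun x hx => ?_
    rw [interior_Ioi] at hx
    rw [(hd x hx).deriv]
    exact hpos x hx

theorem IsUtilityFun.antitoneOn_deriv {u u' : ℝ → ℝ} (hu : IsUtilityFun u u') :
    AntitoneOn u' (Ioi 0) := by
  have h := hu.strictConcave.concaveOn.antitoneOn_deriv
    fun x hx => (hu.hasDeriv x hx).differentiableAt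
  exact h.congr fun x hx => (hu.hasDeriv x hx).deriv

/-- Comparison of two functions on a convex subset of `ℝ` through their derivatives. -/
theorem sub_le_sub_of_hasDerivAt_le {f f' g g' : ℝ → ℝ} {s : Set ℝ} (hs : Convex ℝ s)
    (hf : ∀ x ∈ s, HasDerivAt f (f' x) x) (hg : ∀ x ∈ s, HasDerivAt g (g' x) x)
    (hle : ∀ x ∈ s, f' x ≤ g' x) {a b : ℝ} (ha : a ∈ s) (hb : b ∈ s) (hab : a ≤ b) :
    f b - f a ≤ g b - g a := by
  have hd : ∀ x ∈ s, HasDerivAt (fun y => f y - g y) (f' x - g' x) x :=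
    fun x hx => (hf x hx).sub (hg x hx)
  have h : AntitoneOn (fun y => f y - g y) s := by
    refine antitoneOn_of_deriv_nonpos hs
      (fun x hx => (hd x hx).continuousAt.continuousWithinAt)
      (fun x hx => (hd x (interior_subset hx)).differentiableAt.differentiableWithinAt)
      fun x hx => ?_
    rw [(hd x (interior_subset hx)).deriv]
    exact sub_nonpos.2 (hle x (interior_subset hx))
  have := h ha hb hab
  simp only at this
  linarith

/-- A continuous function on `(0,∞)` that is eventually bounded above is bounded above
on `[1,∞)`. -/
theorem exists_forall_ge_one_le {f : ℝ → ℝ} (hf : ContinuousOn f (Ioi 0)) {M : ℝ}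
    (hM : ∀ᶠ x in atTop, f x ≤ M) : ∃ C : ℝ, ∀ x ≥ (1 : ℝ), f x ≤ C := by
  obtain ⟨R, hR⟩ := eventually_atTop.1 hM
  have hf' : ContinuousOn f (Icc 1 R) := hf.mono fun x hx => zero_lt_one.trans_le hx.1
  obtain ⟨B, hB⟩ := isCompact_Icc.bddAbove_image hf'
  refine ⟨max M B, fun x hx => ?_⟩
  rcases le_total R x with h | h
  · exact (hR x h).trans (le_max_left _ _)
  · exact (hB (mem_image_of_mem f ⟨hx, h⟩)).trans (le_max_right _ _)

/-- If `V` is a utility function and `C > 0`, then `C V(x + 1) + 2 √x` is, up to a constant,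
a utility function. -/
theorem IsUtilityFun.shift_add_sqrt {v v' : ℝ → ℝ} (hv : IsUtilityFun v v')
    (hpos : ∀ x > (0 : ℝ), 0 < v' x) {C : ℝ} (hC : 0 < C) (c : ℝ) :
    IsUtilityFun (fun x => c + C * v (x + 1) + 2 * √x)
      (fun x => C * v' (x + 1) + (√x)⁻¹) := by
  have hsq : Tendsto (fun x : ℝ => √x) (nhdsWithin 0 (Ioi 0)) (nhdsWithin 0 (Ioi 0)) := by
    refine tendsto_nhdsWithin_iff.2 ⟨?_, ?_⟩
    · simpa using (Real.continuous_sqrt.tendsto 0).mono_left nhdsWithin_le_nhds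
    · filter_upwards [self_mem_nhdsWithin] with x hx using Real.sqrt_pos.2 hx
  have hmaps : MapsTo (fun x : ℝ => x + 1) (Ioi 0) (Ioi 0) :=
    fun x hx => add_pos (mem_Ioi.1 hx) one_pos
  apply IsUtilityFun.of_deriv
  · intro x hx
    have h1 : HasDerivAt (fun y => v (y + 1)) (v' (x + 1)) x :=
      (hv.hasDeriv (x + 1) (hmaps hx)).comp_add_const x 1
    have h2 := (Real.hasDerivAt_sqrt hx.ne').const_mul 2
    have h3 : 2 * (1 / (2 * √x)) = (√x)⁻¹ := by rw [one_div, mul_inv]; ring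
    rw [h3] at h2
    exact ((h1.const_mul C).const_add c).add h2
  · intro x hx
    have := mul_pos hC (hpos (x + 1) (hmaps hx))
    have := inv_pos.2 (Real.sqrt_pos.2 hx)
    linarith
  · intro x hx y hy hxy
    have h1 := mul_le_mul_of_nonneg_left
      (hv.antitoneOn_deriv (hmaps hx) (hmaps hy) (add_le_add_left hxy.le 1)) hC.le
    have h2 : (√y)⁻¹ < (√x)⁻¹ :=
      inv_strictAnti₀ (Real.sqrt_pos.2 hx) (Real.sqrt_lt_sqrt (mem_Ioi.1 hx).le hxy)
    exact add_lt_add_of_le_of_lt h1 h2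
  · refine ContinuousOn.add (continuousOn_const.mul (hv.derivCont.comp (by fun_prop) hmaps)) ?_
    exact Real.continuous_sqrt.continuousOn.inv₀ fun x hx => (Real.sqrt_pos.2 hx).ne'
  · refine tendsto_atTop_mono' _ ?_ (tendsto_inv_nhdsGT_zero.comp hsq)
    filter_upwards [self_mem_nhdsWithin] with x hx
    have := mul_pos hC (hpos (x + 1) (hmaps hx))
    simp only [Function.comp_apply]
    linarith
  · have h1 := (hv.inada_infty.comp
      (tendsto_atTop_add_const_right _ (1 : ℝ) tendsto_id)).const_mul C
    have h2 := tendsto_inv_atTop_zero.comp Real.tendsto_sqrt_atTop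
    simpa using h1.add h2

/-- If `k` is a decreasing marginal utility with antiderivative `w`, then `-exp (-w)` is,
up to a constant, a utility function. -/
theorem IsUtilityFun.neg_exp_neg {w k : ℝ → ℝ} (hw : ∀ x > (0 : ℝ), HasDerivAt w (k x) x)
    (hw1 : w 1 = 0) (hpos : ∀ x > (0 : ℝ), 0 < k x) (hanti : StrictAntiOn k (Ioi 0))
    (hcont : ContinuousOn k (Ioi 0)) (hzero : Tendsto k (nhdsWithin 0 (Ioi 0)) atTop)
    (hinfty : Tendsto k atTop (nhds 0)) (c : ℝ) :
    IsUtilityFun (fun x => c - Real.exp (-w x)) (fun x => k x * Real.exp (-w x)) := by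
  have hwc : ContinuousOn w (Ioi 0) := fun x hx => (hw x hx).continuousAt.continuousWithinAt
  have hmono : StrictMonoOn w (Ioi 0) := by
    refine strictMonoOn_of_deriv_pos (convex_Ioi 0) hwc fun x hx => ?_
    rw [interior_Ioi] at hx
    rw [(hw x hx).deriv]
    exact hpos x hx
  apply IsUtilityFun.of_deriv
  · intro x hx
    have h1 : -(Real.exp (-w x) * -k x) = k x * Real.exp (-w x) := by ring
    exact h1 ▸ (hw x hx).neg.exp.const_sub c
  · exact fun x hx => mul_pos (hpos x hx) (Real.exp_pos _)
  · intro x hx y hy hxy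
    exact mul_lt_mul'' (hanti hx hy hxy)
      (Real.exp_lt_exp.2 (neg_lt_neg (hmono hx hy hxy))) (hpos y hy).le (Real.exp_pos _).le
  · exact hcont.mul hwc.neg.rexp
  · refine tendsto_atTop_mono' _ ?_ hzero
    filter_upwards [Ioo_mem_nhdsGT (zero_lt_one' ℝ)] with x hx
    have h := hmono.monotoneOn hx.1 (mem_Ioi.2 one_pos) hx.2.le
    exact le_mul_of_one_le_right (hpos x hx.1).le (Real.one_le_exp (by linarith))
  · refine squeeze_zero' ?_ ?_ hinfty
    · filter_upwards [eventually_gt_atTop 0] with x hx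
      exact mul_nonneg (hpos x hx).le (Real.exp_pos _).le
    · filter_upwards [eventually_ge_atTop 1] with x hx
      have hx0 : (0 : ℝ) < x := one_pos.trans_le hx
      have h := hmono.monotoneOn (mem_Ioi.2 one_pos) hx0 hx
      exact mul_le_of_le_one_right (hpos x hx0).le (Real.exp_le_one_iff.2 (by linarith))

/-- Every deterministic utility field on `[0,T]` admits a
(deterministic) minorant and majorant which are themselves utility functions. -/
theorem utility_field_minorant_majorant
    (T : ℝ) (hT : 0 < T) (U U' : ℝ → ℝ → ℝ) (hU : IsUtilityField T U U') :
    ∃ ul ul' uh uh' : ℝ → ℝ, IsUtilityFun ul ul' ∧ IsUtilityFun uh uh' ∧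
      ∀ t ∈ Set.Icc (0:ℝ) T, ∀ x > (0:ℝ), ul x ≤ U t x ∧ U t x ≤ uh x := by
  obtain ⟨K₁, K₂, hc₁, hc₂, -, ha₂, hp₁, hp₂, hK, L, hL⟩ := hU.marginal_bounds
  obtain ⟨M, hM⟩ := hU.bounded_at_one
  have h0 : (0 : ℝ) ∈ Icc 0 T := ⟨le_rfl, hT.le⟩
  have hV := hU.utility 0 h0
  obtain ⟨C, hC⟩ := exists_forall_ge_one_le (hc₂.div hc₁ fun x hx => (hp₁ x hx).ne') hL
  have hC0 : 0 < C := (div_pos (hp₂ 1 one_pos) (hp₁ 1 one_pos)).trans_le (hC 1 le_rfl)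
  have hK₂V : ∀ x ≥ (1 : ℝ), K₂ x ≤ C * U' 0 x := fun x hx =>
    have hx0 : (0 : ℝ) < x := one_pos.trans_le hx
    ((div_le_iff₀ (hp₁ x hx0)).1 (hC x hx)).trans
      (mul_le_mul_of_nonneg_left (hK 0 h0 x hx0).1 hC0.le)
  have hzero : Tendsto K₂ (nhdsWithin 0 (Ioi 0)) atTop := by
    refine tendsto_atTop_mono' _ ?_ hV.inada_zero
    filter_upwards [self_mem_nhdsWithin] with x hx using (hK 0 h0 x hx).2
  have hinfty : Tendsto K₂ atTop (nhds 0) := by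
    refine squeeze_zero' ?_ ?_ (by simpa using hV.inada_infty.const_mul C)
    · filter_upwards [eventually_gt_atTop 0] with x hx using (hp₂ x hx).le
    · filter_upwards [eventually_ge_atTop 1] with x hx using hK₂V x hx
  set W : ℝ → ℝ := fun x => ∫ y in (1 : ℝ)..x, K₂ y
  have hW1 : W 1 = 0 := intervalIntegral.integral_same
  have hW : ∀ x > (0 : ℝ), HasDerivAt W (K₂ x) x := fun x hx => by
    have hsub : uIcc 1 x ⊆ Ioi 0 := fun y hy => (lt_min one_pos hx).trans_le hy.1
    exact intervalIntegral.integral_hasDerivAt_right (hc₂.mono hsub).intervalIntegrable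
      (hc₂.stronglyMeasurableAtFilter isOpen_Ioi x hx) (hc₂.continuousAt (Ioi_mem_nhds hx))
  refine ⟨_, _, _, _, IsUtilityFun.neg_exp_neg hW hW1 hp₂ ha₂ hc₂ hzero hinfty (-M),
    hV.shift_add_sqrt (fun x hx => (hp₁ x hx).trans_le (hK 0 h0 x hx).1) hC0 (M - C * U 0 1),
    fun t ht x hx => ⟨?_, ?_⟩⟩
  · have hM1 := (abs_le.1 (hM t ht)).1
    rcases le_total x 1 with h | h
    · have h1 := sub_le_sub_of_hasDerivAt_le (convex_Ioi 0) (hU.utility t ht).hasDeriv hW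
        (fun y hy => (hK t ht y hy).2) (mem_Ioi.2 hx) (mem_Ioi.2 one_pos) h
      have h2 := Real.add_one_le_exp (-W x)
      linarith
    · have h1 := (hU.utility t ht).strictMono.monotoneOn (mem_Ioi.2 one_pos) hx h
      have h2 := Real.exp_pos (-W x)
      linarith
  · have hM2 := (abs_le.1 (hM t ht)).2
    have hx1 : (1 : ℝ) ≤ x + 1 := by linarith
    have h1 := (hU.utility t ht).strictMono.monotoneOn (mem_Ioi.2 hx)
      (mem_Ioi.2 (one_pos.trans_le hx1)) (by linarith : x ≤ x + 1)
    have h2 := sub_le_sub_of_hasDerivAt_le (convex_Ici 1)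
      (fun y hy => (hU.utility t ht).hasDeriv y (mem_Ioi.2 (one_pos.trans_le hy)))
      (fun y hy => (hV.hasDeriv y (mem_Ioi.2 (one_pos.trans_le hy))).const_mul C)
      (fun y hy => (hK t ht y (one_pos.trans_le hy)).2.trans (hK₂V y hy))
      self_mem_Ici hx1 hx1
    have h3 := Real.sqrt_nonneg x
    linarith

end
end

section
/- Let U be a deterministic utility field on [0,T] and define its asymptotic elasticity AE[U] = limsup_{x→∞} sup_{t∈[0,T]} (x ∂₂U(t,x) / U(t,x)); assume AE[U] < 1. Define Γ₁ = {γ > 0 : there exists x₀ > 0 such that for all t ∈ [0,T], all λ > 1 and all x ≥ x₀, U(t,λx) < λ^γ U(t,x)} and Γ₂ = {γ > 0 : there exists x₀ > 0 such that for all t ∈ [0,T] and all x ≥ x₀, ∂₂U(t,x) < γ U(t,x)/x}. Then inf Γ₁ = inf Γ₂ = AE[U]. -/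
open MeasureTheory Filter Set

noncomputable section

/-- The asymptotic elasticity
`AE[U] = limsup_{x→∞} sup_{t∈[0,T]} x ∂₂U(t,x) / U(t,x)`. -/
def asymptoticElasticity (T : ℝ) (U U' : ℝ → ℝ → ℝ) : ℝ :=
  Filter.limsup (fun x => sSup ((fun t => x * U' t x / U t x) '' Set.Icc (0:ℝ) T))
    Filter.atTop

/-- If `U' < γ U / x` on `[x, ∞)`, then `s ↦ U s * s ^ (-γ)` strictly decreases there, so `U` grows
strictly slower than the power `γ`. -/
lemma lt_rpow_mul_of_deriv_lt {u u' : ℝ → ℝ} {γ x l : ℝ} (hx : 0 < x) (hl : 1 < l)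
    (hu : ∀ y ≥ x, HasDerivAt u (u' y) y) (hlt : ∀ y ≥ x, u' y < γ * (u y / y)) :
    u (l * x) < l ^ γ * u x := by
  have hderiv : ∀ y ≥ x, HasDerivAt (fun s => u s * s ^ (-γ))
      (u' y * y ^ (-γ) + u y * (-γ * y ^ (-γ - 1))) y := fun y hy =>
    (hu y hy).mul (Real.hasDerivAt_rpow_const (Or.inl (hx.trans_le hy).ne'))
  have hanti : StrictAntiOn (fun s => u s * s ^ (-γ)) (Ici x) := by
    refine strictAntiOn_of_hasDerivWithinAt_neg (convex_Ici x)
      (fun y hy => (hderiv y hy).continuousAt.continuousWithinAt)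
      (fun y hy => (hderiv y (interior_subset hy)).hasDerivWithinAt) fun y hy => ?_
    have hxy : x ≤ y := interior_subset hy
    have hy0 : 0 < y := hx.trans_le hxy
    have hfactor : u' y * y ^ (-γ) + u y * (-γ * y ^ (-γ - 1)) =
        (u' y - γ * (u y / y)) * y ^ (-γ) := by
      rw [Real.rpow_sub_one hy0.ne']
      ring
    rw [hfactor]
    exact mul_neg_of_neg_of_pos (sub_neg.2 (hlt y hxy)) (Real.rpow_pos_of_pos hy0 _)
  have hl0 : 0 < l := one_pos.trans hl
  have hxl : x < l * x := lt_mul_of_one_lt_left hx hl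
  have h := hanti self_mem_Ici hxl.le hxl
  simp only [Real.mul_rpow hl0.le hx.le, Real.rpow_neg hl0.le, Real.rpow_neg hx.le] at h
  have hlγ : 0 < l ^ γ := Real.rpow_pos_of_pos hl0 _
  have hxγ : 0 < x ^ γ := Real.rpow_pos_of_pos hx _
  calc u (l * x) = u (l * x) * ((l ^ γ)⁻¹ * (x ^ γ)⁻¹) * (l ^ γ * x ^ γ) := by field_simp
    _ < u x * (x ^ γ)⁻¹ * (l ^ γ * x ^ γ) := by gcongr
    _ = l ^ γ * u x := by field_simp

/-- Power growth of order `γ` in the scaling parameter bounds the derivative at the base point. -/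
lemma mul_deriv_le_of_scaling_le {u : ℝ → ℝ} {d γ x : ℝ} (hu : HasDerivAt u d x)
    (h : ∀ l > (1 : ℝ), u (l * x) ≤ l ^ γ * u x) : x * d ≤ γ * u x := by
  have hscale : HasDerivAt (fun l : ℝ => u (l * x)) (d * (1 * x)) 1 := by
    have hu' : HasDerivAt u d (1 * x) := by rwa [one_mul]
    exact hu'.comp (1 : ℝ) ((hasDerivAt_id (1 : ℝ)).mul_const x)
  have hpow : HasDerivAt (fun l : ℝ => l ^ γ * u x) (γ * 1 ^ (γ - 1) * u x) 1 :=
    (Real.hasDerivAt_rpow_const (Or.inl one_ne_zero)).mul_const _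
  have hle : d * (1 * x) - γ * 1 ^ (γ - 1) * u x ≤ 0 := by
    refine le_of_tendsto ((hasDerivWithinAt_iff_tendsto_slope' self_notMem_Ioi).1
      (hscale.sub hpow).hasDerivWithinAt) ?_
    filter_upwards [self_mem_nhdsWithin] with l hl
    rw [slope_def_field]
    refine div_nonpos_of_nonpos_of_nonneg ?_ (sub_nonneg.2 (mem_Ioi.1 hl).le)
    simpa using h l hl
  rw [Real.one_rpow] at hle
  linarith

/-- By concavity, the elasticities of a utility field are eventually bounded uniformly in time. -/
lemma IsUtilityField.exists_elasticity_le {T : ℝ} {U U' : ℝ → ℝ → ℝ} (hU : IsUtilityField T U U') :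
    ∃ C : ℝ, ∃ X > (0 : ℝ), ∀ x ≥ X, ∀ t ∈ Icc (0 : ℝ) T,
      0 < U t x ∧ 0 < U' t x ∧ x * U' t x / U t x ≤ C := by
  obtain ⟨K₁, K₂, -, -, -, hK₂, hK₁pos, hK₂pos, hK, -⟩ := hU.marginal_bounds
  obtain ⟨ε, hε, x₀, hpos⟩ := hU.eventually_pos
  set a := max x₀ 1
  have ha : 0 < a := one_pos.trans_le (le_max_right _ _)
  refine ⟨1 + a * K₂ a / ε, a + 1, by linarith, fun x hx t ht => ?_⟩
  have hax : a < x := by linarith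
  have hx0 : 0 < x := ha.trans hax
  have hUx : ε ≤ U t x := hpos x ((le_max_left _ _).trans hax.le) t ht
  have hUa : ε ≤ U t a := hpos a (le_max_left _ _) t ht
  have hUx0 : 0 < U t x := hε.trans_le hUx
  have hslope := (hU.utility t ht).strictConcave.concaveOn.le_slope_of_hasDerivAt ha hx0 hax
    ((hU.utility t ht).hasDeriv x hx0)
  rw [slope_def_field, le_div_iff₀ (sub_pos.2 hax)] at hslope
  have hK₂x : U' t x ≤ K₂ a := (hK t ht x hx0).2.trans (hK₂ ha hx0 hax).le
  refine ⟨hUx0, (hK₁pos x hx0).trans_le (hK t ht x hx0).1, ?_⟩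
  rw [div_le_iff₀ hUx0]
  have hterm : a * K₂ a ≤ a * K₂ a / ε * U t x := by
    calc a * K₂ a = a * K₂ a / ε * ε := by field_simp
      _ ≤ a * K₂ a / ε * U t x :=
        mul_le_mul_of_nonneg_left hUx (div_pos (mul_pos ha (hK₂pos a ha)) hε).le
  nlinarith [mul_le_mul_of_nonneg_left hK₂x ha.le]

lemma IsUtilityField.asymptoticElasticity_bounds {T : ℝ} (hT : 0 ≤ T) {U U' : ℝ → ℝ → ℝ}
    (hU : IsUtilityField T U U') :
    0 ≤ asymptoticElasticity T U U' ∧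
    (∀ γ, (∃ X : ℝ, ∀ t ∈ Icc (0 : ℝ) T, ∀ x ≥ X, x * U' t x ≤ γ * U t x) →
      asymptoticElasticity T U U' ≤ γ) ∧
    (∀ γ > asymptoticElasticity T U U', ∃ X > (0 : ℝ), ∀ t ∈ Icc (0 : ℝ) T, ∀ x ≥ X,
      U' t x < γ * (U t x / x)) := by
  obtain ⟨C, X, hX, hC⟩ := hU.exists_elasticity_le
  have hne : (Icc (0 : ℝ) T).Nonempty := nonempty_Icc.2 hT
  set g : ℝ → ℝ := fun x => sSup ((fun t => x * U' t x / U t x) '' Icc (0 : ℝ) T)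
  have hle : ∀ x ≥ X, ∀ t ∈ Icc (0 : ℝ) T, x * U' t x / U t x ≤ g x := fun x hx t ht =>
    le_csSup ⟨C, forall_mem_image.2 fun s hs => (hC x hx s hs).2.2⟩ (mem_image_of_mem _ ht)
  have hg_le : ∀ x b, (∀ t ∈ Icc (0 : ℝ) T, x * U' t x / U t x ≤ b) → g x ≤ b := fun x b hb =>
    csSup_le (hne.image _) (forall_mem_image.2 hb)
  have hg_nonneg : ∀ x ≥ X, 0 ≤ g x := fun x hx => by
    obtain ⟨t, ht⟩ := hne
    obtain ⟨h₁, h₂, -⟩ := hC x hx t ht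
    exact (div_pos (mul_pos (hX.trans_le hx) h₂) h₁).le.trans (hle x hx t ht)
  have hbdd : IsBoundedUnder (· ≤ ·) atTop g := ⟨C, eventually_map.2 <| by
    filter_upwards [eventually_ge_atTop X] with x hx
    exact hg_le x C fun t ht => (hC x hx t ht).2.2⟩
  have hbdd' : IsBoundedUnder (· ≥ ·) atTop g := ⟨0, eventually_map.2 <| by
    filter_upwards [eventually_ge_atTop X] with x hx using hg_nonneg x hx⟩
  refine ⟨?_, fun γ ⟨Y, hY⟩ => ?_, fun γ hγ => ?_⟩
  · refine le_limsup_of_le hbdd fun b hb => ?_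
    obtain ⟨x, hx, hxb⟩ := ((eventually_ge_atTop X).and hb).exists
    exact (hg_nonneg x hx).trans hxb
  · refine limsup_le_of_le hbdd'.isCoboundedUnder_le ?_
    filter_upwards [eventually_ge_atTop X, eventually_ge_atTop Y] with x hxX hxY
    exact hg_le x γ fun t ht => (div_le_iff₀ (hC x hxX t ht).1).2 (hY t ht x hxY)
  · obtain ⟨Z, hZ⟩ := eventually_atTop.1 (eventually_lt_of_limsup_lt hγ hbdd)
    refine ⟨max X Z, lt_max_of_lt_left hX, fun t ht x hx => ?_⟩
    have hxX : X ≤ x := (le_max_left _ _).trans hx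
    have hlt := (hle x hxX t ht).trans_lt (hZ x ((le_max_right _ _).trans hx))
    rw [div_lt_iff₀ (hC x hxX t ht).1] at hlt
    rw [← mul_div_assoc, lt_div_iff₀ (hX.trans_le hxX), mul_comm]
    exact hlt

lemma csInf_eq_of_Ioi_subset_of_subset_Ici {s : Set ℝ} {a : ℝ} (h₁ : Ioi a ⊆ s) (h₂ : s ⊆ Ici a) :
    sInf s = a :=
  le_antisymm ((csInf_le_csInf ⟨a, h₂⟩ nonempty_Ioi h₁).trans_eq csInf_Ioi)
    (le_csInf (nonempty_Ioi.mono h₁) h₂)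

/-- For a reasonably elastic utility field,
`inf Γ₁ = inf Γ₂ = AE[U]`. -/
theorem asymptotic_elasticity_primal_characterization
    (T : ℝ) (hT : 0 < T) (U U' : ℝ → ℝ → ℝ) (hU : IsUtilityField T U U')
    (hAE : asymptoticElasticity T U U' < 1) :
    sInf {γ : ℝ | 0 < γ ∧ ∃ x₀ > (0:ℝ), ∀ t ∈ Set.Icc (0:ℝ) T, ∀ l > (1:ℝ),
        ∀ x ≥ x₀, U t (l * x) < l ^ γ * U t x} = asymptoticElasticity T U U' ∧
    sInf {γ : ℝ | 0 < γ ∧ ∃ x₀ > (0:ℝ), ∀ t ∈ Set.Icc (0:ℝ) T,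
        ∀ x ≥ x₀, U' t x < γ * (U t x / x)} = asymptoticElasticity T U U' := by
  obtain ⟨hnonneg, hle, hlt⟩ := hU.asymptoticElasticity_bounds hT.le
  refine ⟨csInf_eq_of_Ioi_subset_of_subset_Ici (fun γ hγ => ?_) ?_,
    csInf_eq_of_Ioi_subset_of_subset_Ici (fun γ hγ => ⟨hnonneg.trans_lt hγ, hlt γ hγ⟩) ?_⟩
  · obtain ⟨X, hX, h⟩ := hlt γ hγ
    refine ⟨hnonneg.trans_lt hγ, X, hX, fun t ht l hl x hx => ?_⟩
    exact lt_rpow_mul_of_deriv_lt (hX.trans_le hx) hl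
      (fun y hy => (hU.utility t ht).hasDeriv y ((hX.trans_le hx).trans_le hy))
      (fun y hy => h t ht y (hx.trans hy))
  · rintro γ ⟨-, x₀, hx₀, h⟩
    exact hle γ ⟨x₀, fun t ht x hx => mul_deriv_le_of_scaling_le
      ((hU.utility t ht).hasDeriv x (hx₀.trans_le hx)) fun l hl => (h t ht l hl x hx).le⟩
  · rintro γ ⟨-, x₀, hx₀, h⟩
    refine hle γ ⟨x₀, fun t ht x hx => ?_⟩
    have hx := h t ht x hx
    rw [← mul_div_assoc, lt_div_iff₀ (by linarith), mul_comm] at hx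
    exact hx.le

end
end

section
/- Let U be a deterministic utility field on [0,T]. Then: (a) for every x₀ > 0, the function t ↦ U(t,x₀) is bounded on [0,T]; and (b) either sup_{t∈[0,T]} lim_{x→∞} U(t,x) < ∞, or lim_{x→∞} U(t,x) = ∞ for every t ∈ [0,T]. -/
open MeasureTheory Filter Set

noncomputable section

/-- If `f' ≤ M * g'` on `[a, ∞)`, then the increments of `f` are at most `M` times those of `g`. -/
theorem sub_le_mul_sub_of_deriv_le {f f' g g' : ℝ → ℝ} {a M : ℝ}
    (hf : ∀ x ≥ a, HasDerivAt f (f' x) x) (hg : ∀ x ≥ a, HasDerivAt g (g' x) x)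
    (h : ∀ x ≥ a, f' x ≤ M * g' x) {x : ℝ} (hx : a ≤ x) :
    f x - f a ≤ M * (g x - g a) := by
  have hd : ∀ y ≥ a, HasDerivAt (fun z => M * g z - f z) (M * g' y - f' y) y :=
    fun y hy => ((hg y hy).const_mul M).sub (hf y hy)
  have hmono : MonotoneOn (fun z => M * g z - f z) (Set.Ici a) := by
    apply monotoneOn_of_deriv_nonneg (convex_Ici a)
    · exact fun y hy => (hd y hy).continuousAt.continuousWithinAt
    · exact fun y hy => (hd y (interior_subset hy)).differentiableAt.differentiableWithinAt
    · intro y hy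
      have hy' : a ≤ y := interior_subset hy
      rw [(hd y hy').deriv]
      linarith [h y hy']
  have := hmono Set.self_mem_Ici hx hx
  simp only at this
  linarith

/-- A function that is monotone on `(0, ∞)` either tends to `∞` or is bounded above there. -/
theorem MonotoneOn.tendsto_atTop_or_bddAbove_Ioi {f : ℝ → ℝ} (hf : MonotoneOn f (Set.Ioi 0)) :
    Filter.Tendsto f Filter.atTop Filter.atTop ∨ ∃ B : ℝ, ∀ x > (0:ℝ), f x ≤ B := by
  by_cases h : ∃ B : ℝ, ∀ x > (0:ℝ), f x ≤ B
  · exact Or.inr h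
  · push Not at h
    refine Or.inl (Filter.tendsto_atTop.2 fun B => ?_)
    obtain ⟨x, hx, hB⟩ := h B
    filter_upwards [Filter.eventually_ge_atTop x] with y hy
    exact hB.le.trans (hf hx (lt_of_lt_of_le hx hy) hy)

/-- At each fixed positive wealth, a utility field is bounded in time. -/
theorem IsUtilityField.bounded_in_time {T : ℝ} {U U' : ℝ → ℝ → ℝ} (hU : IsUtilityField T U U')
    {x : ℝ} (hx : 0 < x) : ∃ M : ℝ, ∀ t ∈ Set.Icc (0:ℝ) T, |U t x| ≤ M := by
  obtain ⟨K₁, K₂, -, -, -, hK₂, hpos, -, hK, -⟩ := hU.marginal_bounds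
  obtain ⟨M, hM⟩ := hU.bounded_at_one
  have hm : 0 < min x 1 := lt_min hx one_pos
  refine ⟨K₂ (min x 1) * ‖x - 1‖ + M, fun t ht => ?_⟩
  have key : ‖U t x - U t 1‖ ≤ K₂ (min x 1) * ‖x - 1‖ := by
    refine (convex_Ici (min x 1)).norm_image_sub_le_of_norm_hasDerivWithin_le (f' := U' t)
      (fun y hy => ?_) (fun y hy => ?_) (min_le_right x 1) (min_le_left x 1)
    · exact ((hU.utility t ht).hasDeriv y (hm.trans_le hy)).hasDerivWithinAt
    · have hy0 : 0 < y := hm.trans_le hy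
      have hb := hK t ht y hy0
      rw [Real.norm_of_nonneg ((hpos y hy0).le.trans hb.1)]
      exact hb.2.trans (hK₂.antitoneOn hm hy0 hy)
  rw [Real.norm_eq_abs] at key
  linarith [hM t ht, abs_sub_abs_le_abs_sub (U t x) (U t 1)]

/-- Marginal utilities at different times are comparable at large wealth. -/
theorem IsUtilityField.exists_marginal_le_mul {T : ℝ} {U U' : ℝ → ℝ → ℝ}
    (hU : IsUtilityField T U U') : ∃ M > (0:ℝ), ∃ N > (0:ℝ), ∀ s ∈ Set.Icc (0:ℝ) T,
      ∀ t ∈ Set.Icc (0:ℝ) T, ∀ x ≥ N, U' s x ≤ M * U' t x := by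
  obtain ⟨K₁, K₂, -, -, -, -, hpos₁, hpos₂, hK, M, hM⟩ := hU.marginal_bounds
  obtain ⟨N, hN⟩ := Filter.eventually_atTop.1 hM
  have hN1 : 0 < max N 1 := lt_max_of_lt_right one_pos
  have hM0 : 0 < M :=
    (div_pos (hpos₂ _ hN1) (hpos₁ _ hN1)).trans_le (hN _ (le_max_left N 1))
  refine ⟨M, hM0, max N 1, hN1, fun s hs t ht x hx => ?_⟩
  have hx0 : 0 < x := hN1.trans_le hx
  calc U' s x ≤ K₂ x := (hK s hs x hx0).2
    _ ≤ M * K₁ x := (div_le_iff₀ (hpos₁ x hx0)).1 (hN x ((le_max_left N 1).trans hx))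
    _ ≤ M * U' t x := by gcongr; exact (hK t ht x hx0).1

/-- For a deterministic utility field: (a) `t ↦ U(t,x₀)` is
bounded on `[0,T]` for every `x₀ > 0`; and (b) either `sup_t lim_{x→∞} U(t,x)`
is finite (i.e. `U` is uniformly bounded above), or `U(t,x) → ∞` as `x → ∞` for
every `t ∈ [0,T]`. -/
theorem utility_field_bounded_trajectories
    (T : ℝ) (hT : 0 < T) (U U' : ℝ → ℝ → ℝ) (hU : IsUtilityField T U U') :
    (∀ x₀ > (0:ℝ), ∃ M : ℝ, ∀ t ∈ Set.Icc (0:ℝ) T, |U t x₀| ≤ M) ∧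
    ((∃ M : ℝ, ∀ t ∈ Set.Icc (0:ℝ) T, ∀ x > (0:ℝ), U t x ≤ M) ∨
      (∀ t ∈ Set.Icc (0:ℝ) T,
        Filter.Tendsto (fun x => U t x) Filter.atTop Filter.atTop)) := by
  refine ⟨fun x₀ hx₀ => hU.bounded_in_time hx₀, ?_⟩
  by_contra! hcon
  obtain ⟨hunb, t, ht, hnt⟩ := hcon
  obtain ⟨B, hB⟩ :=
    (hU.utility t ht).strictMono.monotoneOn.tendsto_atTop_or_bddAbove_Ioi.resolve_left hnt
  obtain ⟨M, hM0, N, hN0, hMN⟩ := hU.exists_marginal_le_mul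
  obtain ⟨C, hC⟩ := hU.bounded_in_time hN0
  obtain ⟨s, hs, x, hx, hlt⟩ := hunb (C + M * (B - U t N))
  have hd : ∀ r ∈ Set.Icc (0:ℝ) T, ∀ y ≥ N, HasDerivAt (U r) (U' r y) y :=
    fun r hr y hy => (hU.utility r hr).hasDeriv y (hN0.trans_le hy)
  have hz : 0 < max x N := lt_max_of_lt_left hx
  have h1 := sub_le_mul_sub_of_deriv_le (hd s hs) (hd t ht) (hMN s hs t ht) (le_max_right x N)
  have h2 : U s x ≤ U s (max x N) :=
    (hU.utility s hs).strictMono.monotoneOn hx hz (le_max_left x N)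
  have h3 : M * (U t (max x N) - U t N) ≤ M * (B - U t N) := by
    gcongr
    exact hB _ hz
  linarith [(abs_le.1 (hC s hs)).2]

end
end
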